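/- Optimal link structure for a single node: let I = {i} be a singleton with Ī nonempty, fix E_in(I) and E_Ī such that every node of Ī has at least one outlink in E_in(I) ∪ E_Ī, and let V_0 = {j ∈ Ī : (v_0)_j = max_{k ∈ Ī} (v_0)_k}, where v_0 is computed in the basic absorbing graph. Then an admissible pair (H, F) is optimal (i.e. maximizes the PageRank π_i under Assumption A) if and only if H = {(i,i)} and F = {(i,j)} for some j ∈ V_0. -/

import Mathlib

open Matrix Finset

/-- Outdegree of node `i` in the edge set `E`. -/
def outdeg {n : ℕ} (E : Finset (Fin n × Fin n)) (i : Fin n) : ℕ :=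
  (Finset.univ.filter (fun j => (i, j) ∈ E)).card

/-- The scaled adjacency matrix `P` of the graph: `P i j = 1 / outdeg i` if `(i,j) ∈ E`. -/
noncomputable def Pmat {n : ℕ} (E : Finset (Fin n × Fin n)) : Matrix (Fin n) (Fin n) ℝ :=
  fun i j => if (i, j) ∈ E then ((outdeg E i : ℝ))⁻¹ else 0

/-- Indicator vector of a set of nodes. -/
def ind {n : ℕ} (I : Finset (Fin n)) : Fin n → ℝ :=
  fun i => if i ∈ I then 1 else 0

/-- `v = (Id - cP)⁻¹ e_I`, the vector of mean numbers of visits to `I` before zapping. -/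
noncomputable def vvec {n : ℕ} (c : ℝ) (E : Finset (Fin n × Fin n)) (I : Finset (Fin n)) : Fin n → ℝ :=
  (1 - c • Pmat E)⁻¹ *ᵥ ind I

/-- PageRank vector `πᵀ = (1-c) zᵀ (Id - cP)⁻¹`. -/
noncomputable def pr {n : ℕ} (c : ℝ) (z : Fin n → ℝ) (E : Finset (Fin n × Fin n)) : Fin n → ℝ :=
  (1 - c) • (((1 - c • Pmat E)⁻¹)ᵀ *ᵥ z)

/-- PageRank of the set `I`: `πᵀ e_I`. -/
noncomputable def prSet {n : ℕ} (c : ℝ) (z : Fin n → ℝ) (E : Finset (Fin n × Fin n))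
    (I : Finset (Fin n)) : ℝ :=
  ∑ i ∈ I, pr c z E i

/-- Node `i` has access to (some node of) the set `J`: `i ∈ J` or a directed path from `i`
reaches `J`. -/
def access {n : ℕ} (E : Finset (Fin n × Fin n)) (i : Fin n) (J : Finset (Fin n)) : Prop :=
  ∃ j ∈ J, Relation.ReflTransGen (fun a b => (a, b) ∈ E) i j

/-- A graph is admissible for `I` (Assumption A + well-definedness): every node has at
least one outlink and every node of `I` has access to the complement of `I`. -/
def admissible {n : ℕ} (E : Finset (Fin n × Fin n)) (I : Finset (Fin n)) : Prop :=
  (∀ i, 0 < outdeg E i) ∧ ∀ i ∈ I, access E i Iᶜ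

lemma Pmat_nonneg {n : ℕ} (E : Finset (Fin n × Fin n)) (k j : Fin n) : 0 ≤ Pmat E k j := by
  unfold Pmat
  split_ifs <;> positivity

lemma Pmat_mul_sum {n : ℕ} (E : Finset (Fin n × Fin n)) (k : Fin n) (x : Fin n → ℝ) :
    ∑ j, Pmat E k j * x j
      = (outdeg E k : ℝ)⁻¹ * ∑ j ∈ univ.filter (fun j => (k, j) ∈ E), x j := by
  rw [Finset.mul_sum, Finset.sum_filter]
  refine Finset.sum_congr rfl fun j _ => ?_
  unfold Pmat
  split_ifs <;> simp

lemma Pmat_sum {n : ℕ} (E : Finset (Fin n × Fin n)) (k : Fin n) (h : 0 < outdeg E k) :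
    ∑ j, Pmat E k j = 1 := by
  have h1 := Pmat_mul_sum E k (fun _ => 1)
  simp only [mul_one, Finset.sum_const, nsmul_eq_mul] at h1
  rw [h1]
  have : ((outdeg E k : ℕ) : ℝ) ≠ 0 := by positivity
  exact inv_mul_cancel₀ this

lemma det_unit {n : ℕ} (c : ℝ) (hc0 : 0 < c) (hc1 : c < 1) (E : Finset (Fin n × Fin n))
    (h : ∀ k, 0 < outdeg E k) : IsUnit (1 - c • Pmat E).det := by
  rw [isUnit_iff_ne_zero]
  apply det_ne_zero_of_sum_row_lt_diag
  intro k
  have h1 := Pmat_sum E k (h k)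
  rw [← Finset.add_sum_erase _ _ (Finset.mem_univ k)] at h1
  have h2 : ∑ j ∈ univ.erase k, ‖(1 - c • Pmat E) k j‖ = c * ∑ j ∈ univ.erase k, Pmat E k j := by
    rw [Finset.mul_sum]
    refine Finset.sum_congr rfl fun j hj => ?_
    have hj' : k ≠ j := fun e => (Finset.ne_of_mem_erase hj) e.symm
    have := Pmat_nonneg E k j
    simp only [Matrix.sub_apply, one_apply_ne hj', Matrix.smul_apply, smul_eq_mul, zero_sub, norm_neg,
      Real.norm_eq_abs]
    exact abs_of_nonneg (by positivity)
  rw [h2]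
  have h3 := Pmat_nonneg E k k
  simp only [Matrix.sub_apply, one_apply_eq, Matrix.smul_apply, smul_eq_mul, Real.norm_eq_abs]
  refine lt_of_lt_of_le ?_ (le_abs_self _)
  nlinarith

lemma vvec_eq {n : ℕ} (c : ℝ) (hc0 : 0 < c) (hc1 : c < 1) (E : Finset (Fin n × Fin n))
    (h : ∀ k, 0 < outdeg E k) (I : Finset (Fin n)) (k : Fin n) :
    vvec c E I k = ind I k + c * ∑ j, Pmat E k j * vvec c E I j := by
  have h1 : (1 - c • Pmat E) *ᵥ vvec c E I = ind I := by
    unfold vvec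
    rw [mulVec_mulVec, mul_nonsing_inv _ (det_unit c hc0 hc1 E h), one_mulVec]
  have h2 := congrFun h1 k
  rw [sub_mulVec, one_mulVec, smul_mulVec] at h2
  simp only [Pi.sub_apply, Pi.smul_apply, smul_eq_mul, mulVec, dotProduct] at h2
  linarith

lemma vvec_unique {n : ℕ} (c : ℝ) (hc0 : 0 < c) (hc1 : c < 1) (E : Finset (Fin n × Fin n))
    (h : ∀ k, 0 < outdeg E k) (I : Finset (Fin n)) (x : Fin n → ℝ)
    (hx : ∀ k, x k = ind I k + c * ∑ j, Pmat E k j * x j) : vvec c E I = x := by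
  have h1 : (1 - c • Pmat E) *ᵥ x = ind I := by
    funext k
    rw [sub_mulVec, one_mulVec, smul_mulVec]
    simp only [Pi.sub_apply, Pi.smul_apply, smul_eq_mul, mulVec, dotProduct]
    linarith [hx k]
  unfold vvec
  rw [← h1, mulVec_mulVec, nonsing_inv_mul _ (det_unit c hc0 hc1 E h), one_mulVec]

lemma prSet_eq {n : ℕ} (c : ℝ) (z : Fin n → ℝ) (E : Finset (Fin n × Fin n)) (i : Fin n) :
    prSet c z E {i} = (1 - c) * ∑ k, z k * vvec c E {i} k := by
  unfold prSet pr vvec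
  simp only [Finset.sum_singleton, Pi.smul_apply, smul_eq_mul, mulVec, dotProduct, transpose_apply]
  congr 1
  refine Finset.sum_congr rfl fun k _ => ?_
  simp [ind, mul_comm]

/-- Maximum principle for the hitting vector. -/
lemma bounds {n : ℕ} (c : ℝ) (hc0 : 0 < c) (hc1 : c < 1) (E : Finset (Fin n × Fin n))
    (h : ∀ k, 0 < outdeg E k) (i : Fin n) (a : Fin n → ℝ) (hai : a i = 1)
    (ha : ∀ k, k ≠ i → a k = c * ∑ j, Pmat E k j * a j) :
    (∀ k, 0 ≤ a k) ∧ (∀ k, k ≠ i → a k < 1) := by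
  have : Nonempty (Fin n) := ⟨i⟩
  have hpos : ∀ k, 0 ≤ a k := by
    obtain ⟨k, hk⟩ := Finite.exists_min a
    suffices 0 ≤ a k from fun j => this.trans (hk j)
    by_contra hneg
    push Not at hneg
    have hki : k ≠ i := by rintro rfl; linarith
    have h1 := ha k hki
    have h2 : ∑ j, Pmat E k j * a k ≤ ∑ j, Pmat E k j * a j :=
      Finset.sum_le_sum fun j _ => mul_le_mul_of_nonneg_left (hk j) (Pmat_nonneg E k j)
    rw [← Finset.sum_mul, Pmat_sum E k (h k), one_mul] at h2
    nlinarith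
  have hle : ∀ k, a k ≤ 1 := by
    obtain ⟨k, hk⟩ := Finite.exists_max a
    by_cases hki : k = i
    · intro j; rw [← hai, ← hki]; exact hk j
    · exfalso
      have h1 := ha k hki
      have h2 : ∑ j, Pmat E k j * a j ≤ ∑ j, Pmat E k j * a k :=
        Finset.sum_le_sum fun j _ => mul_le_mul_of_nonneg_left (hk j) (Pmat_nonneg E k j)
      rw [← Finset.sum_mul, Pmat_sum E k (h k), one_mul] at h2
      have h3 := hk i
      nlinarith
  refine ⟨hpos, fun k hki => ?_⟩
  have h1 := ha k hki
  have h2 : ∑ j, Pmat E k j * a j ≤ ∑ j, Pmat E k j * 1 :=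
    Finset.sum_le_sum fun j _ => mul_le_mul_of_nonneg_left (hle j) (Pmat_nonneg E k j)
  simp only [mul_one] at h2
  rw [Pmat_sum E k (h k)] at h2
  nlinarith

/-- Averages over a set containing an element other than `i`. -/
lemma avg_bound {n : ℕ} (i : Fin n) (a : Fin n → ℝ) (m : ℝ) (hai : a i = 1) (hm1 : m < 1)
    (hm : ∀ k, k ≠ i → a k ≤ m) (S : Finset (Fin n)) (hS : ∃ j ∈ S, j ≠ i) :
    (S.card : ℝ)⁻¹ * ∑ j ∈ S, a j ≤ (1 + m) / 2 ∧
    ((1 + m) / 2 ≤ (S.card : ℝ)⁻¹ * ∑ j ∈ S, a j →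
      ∃ j, j ≠ i ∧ a j = m ∧ S = {i, j}) := by
  obtain ⟨j0, hj0, hj0i⟩ := hS
  have hc : 0 < S.card := Finset.card_pos.mpr ⟨j0, hj0⟩
  have hcR : (0 : ℝ) < S.card := by exact_mod_cast hc
  have key : (S.card : ℝ)⁻¹ * ∑ j ∈ S, a j ≤ (1 + m) / 2 ↔
      ∑ j ∈ S, a j ≤ S.card * ((1 + m) / 2) := by
    rw [inv_mul_le_iff₀ hcR]
  have key2 : (1 + m) / 2 ≤ (S.card : ℝ)⁻¹ * ∑ j ∈ S, a j ↔
      S.card * ((1 + m) / 2) ≤ ∑ j ∈ S, a j := by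
    rw [le_inv_mul_iff₀ hcR]
  rw [key, key2]
  have hT : ∑ j ∈ S.erase i, a j ≤ (S.erase i).card * m := by
    rw [← nsmul_eq_mul]
    exact Finset.sum_le_card_nsmul _ _ _ fun j hj => hm j (Finset.ne_of_mem_erase hj)
  by_cases hi : i ∈ S
  · have h1 := Finset.add_sum_erase S a hi
    have h2 := Finset.card_erase_add_one hi
    have h3 : 0 < (S.erase i).card := Finset.card_pos.mpr ⟨j0, Finset.mem_erase.mpr ⟨hj0i, hj0⟩⟩
    have h2R : ((S.erase i).card : ℝ) + 1 = S.card := by exact_mod_cast h2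
    have h3R : (1 : ℝ) ≤ (S.erase i).card := by exact_mod_cast h3
    refine ⟨by rw [← h1, ← h2R, hai]; nlinarith, fun hge => ?_⟩
    rw [← h1, ← h2R, hai] at hge
    have h4 : (S.erase i).card = 1 := by
      have : ((S.erase i).card : ℝ) ≤ 1 := by nlinarith
      have : (S.erase i).card ≤ 1 := by exact_mod_cast this
      omega
    obtain ⟨j, hj⟩ := Finset.card_eq_one.mp h4
    have hji : j ≠ i := Finset.ne_of_mem_erase (s := S) (by rw [hj]; simp)
    refine ⟨j, hji, le_antisymm (hm j hji) ?_, ?_⟩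
    · rw [hj] at hge
      simp at hge
      linarith
    · rw [← hj, Finset.insert_erase hi]
  · rw [Finset.erase_eq_of_notMem hi] at hT
    have : (S.card : ℝ) * m < S.card * ((1 + m) / 2) := by
      apply mul_lt_mul_of_pos_left _ hcR; linarith
    exact ⟨by linarith, fun h => by linarith⟩

/-- Corollary 15 (Optimal link structure for a single node): for `I = {i}`, an
admissible pair `(H, F)` maximizes the PageRank `π_i` if and only if `H = {(i,i)}` and
`F = {(i,j)}` for some `j ∈ V₀`, the argmax of `v₀` over `Ī` computed in the basic
absorbing graph `E⁰ = {(i,i)} ∪ E_in(I) ∪ E_Ī`. -/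
theorem stmt16 {n : ℕ} (hn : 1 ≤ n) (c : ℝ) (hc0 : 0 < c) (hc1 : c < 1)
    (z : Fin n → ℝ) (hz : ∀ i, 0 < z i) (hz1 : ∑ i, z i = 1)
    (i : Fin n) (hIc : (({i} : Finset (Fin n))ᶜ).Nonempty)
    (Ein Eext : Finset (Fin n × Fin n))
    (hEin : ∀ p ∈ Ein, p.1 ≠ i ∧ p.2 = i)
    (hEext : ∀ p ∈ Eext, p.1 ≠ i ∧ p.2 ≠ i)
    (hout : ∀ j, j ≠ i → ∃ k, (j, k) ∈ Ein ∪ Eext)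
    (H F : Finset (Fin n × Fin n))
    (hH : ∀ p ∈ H, p.1 = i ∧ p.2 = i) (hF : ∀ p ∈ F, p.1 = i ∧ p.2 ≠ i)
    (hAdm : admissible (H ∪ F ∪ Ein ∪ Eext) {i}) :
    (∀ H' F' : Finset (Fin n × Fin n),
      (∀ p ∈ H', p.1 = i ∧ p.2 = i) → (∀ p ∈ F', p.1 = i ∧ p.2 ≠ i) →
      admissible (H' ∪ F' ∪ Ein ∪ Eext) {i} →
      prSet c z (H' ∪ F' ∪ Ein ∪ Eext) {i} ≤ prSet c z (H ∪ F ∪ Ein ∪ Eext) {i}) ↔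
    (H = {(i, i)} ∧ ∃ j : Fin n, j ≠ i ∧
      (∀ k, k ≠ i →
        vvec c ({(i, i)} ∪ Ein ∪ Eext) {i} k ≤ vvec c ({(i, i)} ∪ Ein ∪ Eext) {i} j) ∧
      F = {(i, j)}) := by
  classical
  set E0 : Finset (Fin n × Fin n) := {(i, i)} ∪ Ein ∪ Eext with hE0
  have h0mem : ∀ k j, k ≠ i → ((k, j) ∈ E0 ↔ (k, j) ∈ Ein ∪ Eext) := by
    intro k j hk
    simp [hE0, hk]
  have hEmem : ∀ H' F' : Finset (Fin n × Fin n), (∀ p ∈ H', p.1 = i ∧ p.2 = i) →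
      (∀ p ∈ F', p.1 = i ∧ p.2 ≠ i) → ∀ k j, k ≠ i →
      ((k, j) ∈ H' ∪ F' ∪ Ein ∪ Eext ↔ (k, j) ∈ E0) := by
    intro H' F' hH' hF' k j hk
    rw [h0mem k j hk]
    have h1 : (k, j) ∉ H' := fun h => hk (hH' _ h).1
    have h2 : (k, j) ∉ F' := fun h => hk (hF' _ h).1
    simp [h1, h2]
  have hP : ∀ H' F' : Finset (Fin n × Fin n), (∀ p ∈ H', p.1 = i ∧ p.2 = i) →
      (∀ p ∈ F', p.1 = i ∧ p.2 ≠ i) → ∀ k j, k ≠ i →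
      Pmat (H' ∪ F' ∪ Ein ∪ Eext) k j = Pmat E0 k j := by
    intro H' F' hH' hF' k j hk
    unfold Pmat outdeg
    simp only [hEmem H' F' hH' hF' k _ hk]
  have hd0' : ∀ k, k ≠ i → 0 < outdeg E0 k := by
    intro k hk
    obtain ⟨j, hj⟩ := hout k hk
    exact Finset.card_pos.mpr ⟨j, by simp only [Finset.mem_filter, Finset.mem_univ, true_and]; exact (h0mem k j hk).mpr hj⟩
  have hi0 : univ.filter (fun j => (i, j) ∈ E0) = {i} := by
    ext j
    have h1 : (i, j) ∉ Ein := fun h => (hEin _ h).1 rfl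
    have h2 : (i, j) ∉ Eext := fun h => (hEext _ h).1 rfl
    simp [hE0, h1, h2]
  have hd0 : ∀ k, 0 < outdeg E0 k := by
    intro k
    by_cases hk : k = i
    · subst hk; unfold outdeg; rw [hi0]; simp
    · exact hd0' k hk
  set w := vvec c E0 {i} with hw
  have hw1 := vvec_eq c hc0 hc1 E0 hd0 {i}
  rw [← hw] at hw1
  have hwi : (1 - c) * w i = 1 := by
    have h := hw1 i
    rw [Pmat_mul_sum, hi0] at h
    unfold outdeg at h
    rw [hi0] at h
    simp [ind] at h
    linarith
  have hc1' : 0 < 1 - c := by linarith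
  set a : Fin n → ℝ := fun k => (1 - c) * w k with ha_def
  have hai : a i = 1 := hwi
  have ha : ∀ k, k ≠ i → a k = c * ∑ j, Pmat E0 k j * a j := by
    intro k hk
    have h := hw1 k
    simp only [ind, Finset.mem_singleton, hk, if_false, zero_add] at h
    have : ∑ j, Pmat E0 k j * a j = (1 - c) * ∑ j, Pmat E0 k j * w j := by
      rw [Finset.mul_sum]
      exact Finset.sum_congr rfl fun j _ => by simp only [ha_def]; ring
    rw [this]
    simp only [ha_def]
    linear_combination (1 - c) * h
  obtain ⟨hapos, halt⟩ := bounds c hc0 hc1 E0 hd0 i a hai ha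
  obtain ⟨js, hjs, hjmax⟩ := Finset.exists_max_image _ a hIc
  have hjsi : js ≠ i := by simpa using hjs
  have hmax : ∀ k, k ≠ i → a k ≤ a js := fun k hk => hjmax k (by simpa using hk)
  have hm1 : a js < 1 := halt js hjsi
  set Z := ∑ k, z k * a k with hZ
  have hZpos : 0 < Z := by
    refine Finset.sum_pos' (fun k _ => mul_nonneg (hz k).le (hapos k)) ⟨i, Finset.mem_univ i, ?_⟩
    rw [hai, mul_one]; exact hz i
  have hiS : ∀ H' F' : Finset (Fin n × Fin n), ∀ j,
      ((i, j) ∈ H' ∪ F' ∪ Ein ∪ Eext ↔ (i, j) ∈ H' ∪ F') := by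
    intro H' F' j
    have h1 : (i, j) ∉ Ein := fun h => (hEin _ h).1 rfl
    have h2 : (i, j) ∉ Eext := fun h => (hEext _ h).1 rfl
    simp [h1, h2]
  have hacc : ∀ E : Finset (Fin n × Fin n), admissible E {i} →
      ∃ j ∈ univ.filter (fun j => (i, j) ∈ E), j ≠ i := by
    intro E hE
    obtain ⟨j, hj, hp⟩ := hE.2 i (by simp)
    have hji : j ≠ i := by simpa using hj
    by_contra hno
    push Not at hno
    apply hji
    clear hj hji
    induction hp with
    | refl => rfl
    | tail _ hbc ih => subst ih; exact hno _ (by simpa using hbc)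
  -- the average over the successors of `i`
  let A : Finset (Fin n × Fin n) → ℝ := fun E =>
    ((univ.filter (fun j => (i, j) ∈ E)).card : ℝ)⁻¹ * ∑ j ∈ univ.filter (fun j => (i, j) ∈ E), a j
  have hAle : ∀ E, admissible E {i} → A E ≤ (1 + a js) / 2 := fun E hE =>
    (avg_bound i a (a js) hai hm1 hmax _ (hacc E hE)).1
  have hpr : ∀ H' F' : Finset (Fin n × Fin n), (∀ p ∈ H', p.1 = i ∧ p.2 = i) →
      (∀ p ∈ F', p.1 = i ∧ p.2 ≠ i) → admissible (H' ∪ F' ∪ Ein ∪ Eext) {i} →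
      prSet c z (H' ∪ F' ∪ Ein ∪ Eext) {i}
        = (1 - c) * Z * (1 - c * A (H' ∪ F' ∪ Ein ∪ Eext))⁻¹ := by
    intro H' F' hH' hF' hE
    have hAl := hAle _ hE
    have hrow := Pmat_mul_sum (H' ∪ F' ∪ Ein ∪ Eext) i a
    set E := H' ∪ F' ∪ Ein ∪ Eext with hEd
    have hrow' : ∑ j, Pmat E i j * a j = A E := hrow
    have hden : 1 - c * A E ≠ 0 := by
      have : 0 < 1 - c * A E := by nlinarith
      exact this.ne'
    have hv : vvec c E {i} = fun k => (1 - c * A E)⁻¹ * a k := by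
      apply vvec_unique c hc0 hc1 E hE.1
      intro k
      have hs : ∑ j, Pmat E k j * ((1 - c * A E)⁻¹ * a j)
          = (1 - c * A E)⁻¹ * ∑ j, Pmat E k j * a j := by
        rw [Finset.mul_sum]
        exact Finset.sum_congr rfl fun j _ => by ring
      rw [hs]
      by_cases hk : k = i
      · subst hk
        rw [hrow', hai]
        simp only [ind, Finset.mem_singleton, if_true]
        field_simp
        ring
      · have : ∑ j, Pmat E k j * a j = ∑ j, Pmat E0 k j * a j :=
          Finset.sum_congr rfl fun j _ => by rw [hEd, hP H' F' hH' hF' k j hk]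
        rw [this]
        have h2 := ha k hk
        simp only [ind, Finset.mem_singleton, hk, if_false, zero_add]
        linear_combination (1 - c * A E)⁻¹ * h2
    rw [prSet_eq, hv, hZ, mul_assoc, Finset.sum_mul]
    congr 1
    exact Finset.sum_congr rfl fun j _ => by ring
  have hcmp : ∀ x y : ℝ, x ≤ (1 + a js) / 2 → y ≤ (1 + a js) / 2 →
      ((1 - c) * Z * (1 - c * x)⁻¹ ≤ (1 - c) * Z * (1 - c * y)⁻¹ ↔ x ≤ y) := by
    intro x y hx hy
    have hx' : 0 < 1 - c * x := by nlinarith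
    have hy' : 0 < 1 - c * y := by nlinarith
    rw [mul_le_mul_iff_right₀ (by positivity), inv_le_inv₀ hx' hy']
    constructor
    · intro h; nlinarith
    · intro h; nlinarith
  have hopt : ∀ j, j ≠ i → A ({(i, i)} ∪ {(i, j)} ∪ Ein ∪ Eext) = (1 + a j) / 2 := by
    intro j hj
    have : univ.filter (fun k => (i, k) ∈ ({(i, i)} ∪ {(i, j)} ∪ Ein ∪ Eext : Finset (Fin n × Fin n))) = {i, j} := by
      ext k
      simp only [Finset.mem_filter, Finset.mem_univ, true_and, hiS]
      simp
    simp only [A]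
    rw [this, Finset.card_pair hj.symm, Finset.sum_pair hj.symm, hai]
    push_cast
    ring
  have hHs : ∀ p ∈ ({(i, i)} : Finset (Fin n × Fin n)), p.1 = i ∧ p.2 = i := by
    intro p hp; rw [Finset.mem_singleton] at hp; subst hp; exact ⟨rfl, rfl⟩
  constructor
  · intro hall
    have hFs : ∀ p ∈ ({(i, js)} : Finset (Fin n × Fin n)), p.1 = i ∧ p.2 ≠ i := by
      intro p hp; rw [Finset.mem_singleton] at hp; subst hp; exact ⟨rfl, hjsi⟩
    have hadm' : admissible ({(i, i)} ∪ {(i, js)} ∪ Ein ∪ Eext) {i} := by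
      refine ⟨fun k => ?_, fun k hk => ?_⟩
      · by_cases hk : k = i
        · subst hk
          exact Finset.card_pos.mpr ⟨k, by simp⟩
        · obtain ⟨j, hj⟩ := hd0' k hk |> Finset.card_pos.mp
          refine Finset.card_pos.mpr ⟨j, ?_⟩
          simp only [Finset.mem_filter, Finset.mem_univ, true_and] at hj ⊢
          exact (hEmem _ _ hHs hFs k j hk).mpr hj
      · rw [Finset.mem_singleton] at hk
        subst hk
        exact ⟨js, hjs, Relation.ReflTransGen.single (by simp)⟩
    have h := hall _ _ hHs hFs hadm'
    rw [hpr _ _ hHs hFs hadm', hpr _ _ hH hF hAdm, hcmp _ _ (hAle _ hadm') (hAle _ hAdm),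
      hopt js hjsi] at h
    obtain ⟨j, hji, hjm, hS⟩ := (avg_bound i a (a js) hai hm1 hmax _ (hacc _ hAdm)).2 h
    have hS' : ∀ k, (i, k) ∈ H ∪ F ↔ k = i ∨ k = j := by
      intro k
      rw [← hiS]
      have := Finset.ext_iff.mp hS k
      simpa only [Finset.mem_filter, Finset.mem_univ, true_and, Finset.mem_insert,
        Finset.mem_singleton] using this
    refine ⟨?_, j, hji, ?_, ?_⟩
    · ext ⟨p, q⟩
      rw [Finset.mem_singleton, Prod.mk.injEq]
      constructor
      · exact fun hp => hH _ hp
      · rintro ⟨rfl, rfl⟩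
        have h1 := (hS' q).mpr (Or.inl rfl)
        rcases Finset.mem_union.mp h1 with h2 | h2
        · exact h2
        · exact absurd rfl (hF _ h2).2
    · intro k hk
      have h1 := hmax k hk
      rw [← hjm] at h1
      exact le_of_mul_le_mul_left h1 hc1'
    · ext ⟨p, q⟩
      rw [Finset.mem_singleton, Prod.mk.injEq]
      constructor
      · intro hp
        have h1 := hF _ hp
        have h2 : p = i := h1.1
        subst h2
        refine ⟨rfl, ?_⟩
        rcases (hS' q).mp (Finset.mem_union_right _ hp) with h3 | h3
        · exact absurd h3 h1.2
        · exact h3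
      · rintro ⟨rfl, rfl⟩
        have h1 := (hS' q).mpr (Or.inr rfl)
        rcases Finset.mem_union.mp h1 with h2 | h2
        · exact absurd (hH _ h2).2 hji
        · exact h2
  · rintro ⟨hHe, j, hji, hjm, hFe⟩ H' F' hH' hF' hadm'
    rw [hpr _ _ hH' hF' hadm', hpr _ _ hH hF hAdm, hcmp _ _ (hAle _ hadm') (hAle _ hAdm)]
    have h1 : A (H ∪ F ∪ Ein ∪ Eext) = (1 + a j) / 2 := by
      rw [hHe, hFe]; exact hopt j hji
    have h2 : a js ≤ a j := mul_le_mul_of_nonneg_left (hjm js hjsi) hc1'.le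
    rw [h1]
    have h3 := hAle _ hadm'
    linarith
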